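/- Every classical finitely additive probability measure μ on a BD-model ⟨W, v⁺, v⁻⟩ is a 4-probability: for all BD formulas φ, ψ it satisfies (part) μ(|φ|ᵇ)+μ(|φ|ᵈ)+μ(|φ|ᶜ)+μ(|φ|ᵘ)=1; (neg) μ(|¬φ|ᵇ)=μ(|φ|ᵈ) and μ(|¬φ|ᶜ)=μ(|φ|ᶜ); (contr) μ(|φ∧¬φ|ᵇ)=0 and μ(|φ∧¬φ|ᶜ)=μ(|φ|ᶜ); (BCmon) if |φ|⁺ ⊆ |ψ|⁺ then μ(|φ|ᵇ)+μ(|φ|ᶜ) ≤ μ(|ψ|ᵇ)+μ(|ψ|ᶜ); and (BCex) μ(|φ|ᵇ)+μ(|φ|ᶜ)+μ(|ψ|ᵇ)+μ(|ψ|ᶜ) = μ(|φ∧ψ|ᵇ)+μ(|φ∧ψ|ᶜ)+μ(|φ∨ψ|ᵇ)+μ(|φ∨ψ|ᶜ). -/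

import Mathlib

inductive BD where
  | var : ℕ → BD
  | neg : BD → BD
  | and : BD → BD → BD
  | or  : BD → BD → BD

/-- Belnap–Dunn semantics: `(sat vp vn φ w).1` is support of truth,
`(sat vp vn φ w).2` is support of falsity. -/
def sat {W : Type} (vp vn : ℕ → Set W) : BD → W → Prop × Prop
  | .var p, w => (w ∈ vp p, w ∈ vn p)
  | .neg φ, w => ((sat vp vn φ w).2, (sat vp vn φ w).1)
  | .and φ ψ, w => ((sat vp vn φ w).1 ∧ (sat vp vn ψ w).1,
                    (sat vp vn φ w).2 ∨ (sat vp vn ψ w).2)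
  | .or φ ψ, w => ((sat vp vn φ w).1 ∨ (sat vp vn ψ w).1,
                   (sat vp vn φ w).2 ∧ (sat vp vn ψ w).2)

def posExt {W : Type} (vp vn : ℕ → Set W) (φ : BD) : Set W := {w | (sat vp vn φ w).1}
def negExt {W : Type} (vp vn : ℕ → Set W) (φ : BD) : Set W := {w | (sat vp vn φ w).2}

def bExt {W : Type} (vp vn : ℕ → Set W) (φ : BD) : Set W := posExt vp vn φ \ negExt vp vn φ
def dExt {W : Type} (vp vn : ℕ → Set W) (φ : BD) : Set W := negExt vp vn φ \ posExt vp vn φ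
def cExt {W : Type} (vp vn : ℕ → Set W) (φ : BD) : Set W := posExt vp vn φ ∩ negExt vp vn φ
def uExt {W : Type} (vp vn : ℕ → Set W) (φ : BD) : Set W := (posExt vp vn φ ∪ negExt vp vn φ)ᶜ

/-- A finitely additive set function splits along intersection and difference. -/
theorem additive_diff_add_inter {W : Type} {μ : Set W → ℝ}
    (hadd : ∀ A B : Set W, Disjoint A B → μ (A ∪ B) = μ A + μ B) (A B : Set W) :
    μ (A \ B) + μ (A ∩ B) = μ A := by
  rw [← hadd _ _ Set.disjoint_sdiff_inter, Set.sdiff_union_inter]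

theorem additive_union_add_inter {W : Type} {μ : Set W → ℝ}
    (hadd : ∀ A B : Set W, Disjoint A B → μ (A ∪ B) = μ A + μ B) (A B : Set W) :
    μ (A ∪ B) + μ (A ∩ B) = μ A + μ B := by
  have hB := additive_diff_add_inter hadd B A
  rw [← Set.union_sdiff_self, hadd _ _ Set.disjoint_sdiff_right, Set.inter_comm]
  linarith

theorem additive_bExt_add_cExt {W : Type} {vp vn : ℕ → Set W} {μ : Set W → ℝ}
    (hadd : ∀ A B : Set W, Disjoint A B → μ (A ∪ B) = μ A + μ B) (φ : BD) :
    μ (bExt vp vn φ) + μ (cExt vp vn φ) = μ (posExt vp vn φ) :=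
  additive_diff_add_inter hadd _ _

theorem bExt_and_neg {W : Type} (vp vn : ℕ → Set W) (φ : BD) :
    bExt vp vn (BD.and φ (BD.neg φ)) = ∅ := by
  ext w
  simp only [bExt, posExt, negExt, sat, Set.mem_sdiff, Set.mem_ofPred_eq, Set.mem_empty_iff_false]
  tauto

theorem cExt_and_neg {W : Type} (vp vn : ℕ → Set W) (φ : BD) :
    cExt vp vn (BD.and φ (BD.neg φ)) = cExt vp vn φ := by
  ext w
  simp only [cExt, posExt, negExt, sat, Set.mem_inter_iff, Set.mem_ofPred_eq]
  tauto

theorem cExt_neg {W : Type} (vp vn : ℕ → Set W) (φ : BD) :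
    cExt vp vn (BD.neg φ) = cExt vp vn φ :=
  Set.inter_comm _ _

theorem stmt6 {W : Type} (vp vn : ℕ → Set W) (μ : Set W → ℝ)
    (hadd : ∀ A B : Set W, Disjoint A B → μ (A ∪ B) = μ A + μ B)
    (h0 : μ ∅ = 0) (h1 : μ Set.univ = 1)
    (hrange : ∀ X : Set W, 0 ≤ μ X ∧ μ X ≤ 1) :
    (∀ φ : BD, μ (bExt vp vn φ) + μ (dExt vp vn φ) + μ (cExt vp vn φ) + μ (uExt vp vn φ) = 1) ∧
    (∀ φ : BD, μ (bExt vp vn (BD.neg φ)) = μ (dExt vp vn φ) ∧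
      μ (cExt vp vn (BD.neg φ)) = μ (cExt vp vn φ)) ∧
    (∀ φ : BD, μ (bExt vp vn (BD.and φ (BD.neg φ))) = 0 ∧
      μ (cExt vp vn (BD.and φ (BD.neg φ))) = μ (cExt vp vn φ)) ∧
    (∀ φ ψ : BD, posExt vp vn φ ⊆ posExt vp vn ψ →
      μ (bExt vp vn φ) + μ (cExt vp vn φ) ≤ μ (bExt vp vn ψ) + μ (cExt vp vn ψ)) ∧
    (∀ φ ψ : BD,
      μ (bExt vp vn φ) + μ (cExt vp vn φ) + μ (bExt vp vn ψ) + μ (cExt vp vn ψ) =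
      μ (bExt vp vn (BD.and φ ψ)) + μ (cExt vp vn (BD.and φ ψ)) +
      μ (bExt vp vn (BD.or φ ψ)) + μ (cExt vp vn (BD.or φ ψ))) := by
  refine ⟨fun φ => ?_, fun φ => ⟨rfl, by rw [cExt_neg]⟩,
    fun φ => ⟨by rw [bExt_and_neg, h0], by rw [cExt_and_neg]⟩, fun φ ψ h => ?_, fun φ ψ => ?_⟩
  · have hb := additive_bExt_add_cExt (vp := vp) (vn := vn) hadd φ
    have hd : μ (posExt vp vn φ ∪ negExt vp vn φ) = μ (posExt vp vn φ) + μ (dExt vp vn φ) := by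
      rw [← Set.union_sdiff_self, hadd _ _ Set.disjoint_sdiff_right, dExt]
    have hu := hadd _ _ (disjoint_compl_right (a := posExt vp vn φ ∪ negExt vp vn φ))
    rw [Set.union_compl_self, h1] at hu
    rw [uExt]
    linarith
  · rw [additive_bExt_add_cExt hadd, additive_bExt_add_cExt hadd, ← Set.union_sdiff_cancel h,
      hadd _ _ Set.disjoint_sdiff_right]
    linarith [(hrange (posExt vp vn ψ \ posExt vp vn φ)).1]
  · have hφ := additive_bExt_add_cExt (vp := vp) (vn := vn) hadd φ
    have hψ := additive_bExt_add_cExt (vp := vp) (vn := vn) hadd ψ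
    have hand : μ (bExt vp vn (BD.and φ ψ)) + μ (cExt vp vn (BD.and φ ψ)) =
        μ (posExt vp vn φ ∩ posExt vp vn ψ) := additive_bExt_add_cExt hadd _
    have hor : μ (bExt vp vn (BD.or φ ψ)) + μ (cExt vp vn (BD.or φ ψ)) =
        μ (posExt vp vn φ ∪ posExt vp vn ψ) := additive_bExt_add_cExt hadd _
    linarith [additive_union_add_inter hadd (posExt vp vn φ) (posExt vp vn ψ)]
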